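/- Let P0 = N(0, σ²I_N), P1 = N(0, Σ1), P2 = N(0, Σ2) be N-dimensional zero-mean Gaussian distributions with Σ1, Σ2 positive definite and σ² > 0. Then P1 is dominated by P2 with respect to P0 (i.e., ∫ (dP2/dP0)/(dP1/dP0) dP0 ≤ 1) if and only if the matrix I + σ²(Σ2⁻¹ − Σ1⁻¹) is positive definite and det(Σ2⁻¹Σ1) ≤ det(I + σ²(Σ2⁻¹ − Σ1⁻¹)); moreover when I + σ²(Σ2⁻¹ − Σ1⁻¹) fails to be positive semidefinite the integral diverges. -/

import Mathlib

open MeasureTheory Matrix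

/-- Zero-mean multivariate Gaussian density with covariance matrix `S`. -/
noncomputable def gaussDensity {N : ℕ} (S : Matrix (Fin N) (Fin N) ℝ)
    (y : Fin N → ℝ) : ℝ :=
  (2 * Real.pi) ^ (-(N : ℝ) / 2) * S.det ^ (-(1 : ℝ) / 2) *
    Real.exp (-(1 / 2) * (y ⬝ᵥ S⁻¹.mulVec y))

theorem lintegral_fin_nat_prod_eq_prod {n : ℕ} {E : Fin n → Type*}
    {mE : ∀ i, MeasurableSpace (E i)} {μ : (i : Fin n) → Measure (E i)} [∀ i, SigmaFinite (μ i)]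
    {f : (i : Fin n) → E i → ENNReal} (hf : ∀ i, Measurable (f i)) :
    ∫⁻ x : (i : Fin n) → E i, ∏ i, f i (x i) ∂(Measure.pi μ) = ∏ i, ∫⁻ x, f i x ∂(μ i) := by
  induction n with
  | zero => simp
  | succ n ih =>
    calc
      _ = ∫⁻ x : E 0 × ((i : Fin n) → E (Fin.succ i)),
            f 0 x.1 * ∏ i : Fin n, f (Fin.succ i) (x.2 i) ∂((μ 0).prod
              (Measure.pi (fun i ↦ μ i.succ))) := by
        rw [← ((measurePreserving_piFinSuccAbove μ 0).symm).lintegral_comp (by fun_prop)]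
        simp_rw [MeasurableEquiv.piFinSuccAbove_symm_apply, Fin.insertNthEquiv,
          Fin.prod_univ_succ, Fin.insertNth_zero, Equiv.coe_fn_mk, Fin.cons_succ,
          Fin.zero_succAbove, Fin.cons_zero]
        rfl
      _ = _ := by
        rw [lintegral_prod_mul (f := f 0)
            (g := fun x : (i : Fin n) → E i.succ ↦ ∏ i, f i.succ (x i)) (hf 0).aemeasurable
            (Finset.measurable_prod _ fun i _ ↦
              (hf i.succ).comp (measurable_pi_apply i)).aemeasurable,
          ih fun i ↦ hf _, Fin.prod_univ_succ]

theorem lintegral_exp_neg_half_mul_sq {a : ℝ} (ha : 0 < a) :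
    ∫⁻ x : ℝ, ENNReal.ofReal (Real.exp (-(1 / 2) * (a * x ^ 2))) =
      ENNReal.ofReal √(2 * Real.pi / a) := by
  have h : ∀ x : ℝ, -(1 / 2) * (a * x ^ 2) = -(a / 2) * x ^ 2 := fun x ↦ by ring
  simp_rw [h]
  rw [← ofReal_integral_eq_lintegral_ofReal (integrable_exp_neg_mul_sq (half_pos ha))
    (.of_forall fun x ↦ (Real.exp_pos _).le), integral_gaussian]
  congr 2
  field_simp

theorem lintegral_exp_neg_half_mul_sq_eq_top {a : ℝ} (ha : a ≤ 0) :
    ∫⁻ x : ℝ, ENNReal.ofReal (Real.exp (-(1 / 2) * (a * x ^ 2))) = ⊤ := by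
  rw [← top_le_iff]
  calc (⊤ : ENNReal) = ∫⁻ _ : ℝ, 1 := by simp
    _ ≤ _ := by
      refine lintegral_mono fun x ↦ ENNReal.one_le_ofReal.mpr (Real.one_le_exp ?_)
      nlinarith [mul_nonneg (neg_nonneg.mpr ha) (sq_nonneg x)]

section Quadratic

variable {N : ℕ} {A : Matrix (Fin N) (Fin N) ℝ}

theorem lintegral_exp_quadratic_eq_prod (hA : A.IsHermitian) :
    ∫⁻ y : Fin N → ℝ, ENNReal.ofReal (Real.exp (-(1 / 2) * (y ⬝ᵥ A *ᵥ y))) =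
      ∏ i, ∫⁻ x : ℝ, ENNReal.ofReal (Real.exp (-(1 / 2) * (hA.eigenvalues i * x ^ 2))) := by
  set U : Matrix (Fin N) (Fin N) ℝ := hA.eigenvectorUnitary.1
  have hUU : Uᵀ * U = 1 := (Matrix.mem_unitaryGroup_iff').mp hA.eigenvectorUnitary.2
  have hdet : U.det * U.det = 1 := by simpa using congrArg det hUU
  have hdiag : Uᵀ * A * U = diagonal hA.eigenvalues := by
    simpa using! hA.conjStarAlgAut_star_eigenvectorUnitary
  have hquad (y : Fin N → ℝ) :
      (U *ᵥ y) ⬝ᵥ A *ᵥ (U *ᵥ y) = ∑ i, hA.eigenvalues i * y i ^ 2 := by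
    rw [← vecMul_transpose, ← dotProduct_mulVec, vecMul_transpose, mulVec_mulVec, mulVec_mulVec,
      hdiag]
    simp only [dotProduct, mulVec_diagonal]
    exact Finset.sum_congr rfl fun i _ ↦ by ring
  have hmp : MeasurePreserving (toLin' U) volume volume := by
    refine ⟨(toLin' U).continuous_of_finiteDimensional.measurable, ?_⟩
    rw [Real.map_matrix_volume_pi_eq_smul_volume_pi (left_ne_zero_of_mul_eq_one hdet), abs_inv,
      show |U.det| = 1 from (pow_eq_one_iff_of_nonneg (abs_nonneg _) two_ne_zero).mp
        (by rw [sq_abs, sq, hdet])]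
    simp
  rw [← hmp.lintegral_comp (by fun_prop), ← lintegral_fin_nat_prod_eq_prod fun i ↦ by fun_prop]
  refine lintegral_congr fun y ↦ ?_
  rw [toLin'_apply, hquad, Finset.mul_sum, Real.exp_sum,
    ENNReal.ofReal_prod_of_nonneg fun i _ ↦ (Real.exp_pos _).le]

theorem lintegral_exp_quadratic (hA : A.PosDef) :
    ∫⁻ y : Fin N → ℝ, ENNReal.ofReal (Real.exp (-(1 / 2) * (y ⬝ᵥ A *ᵥ y))) =
      ENNReal.ofReal ((2 * Real.pi) ^ ((N : ℝ) / 2) * A.det ^ (-(1 : ℝ) / 2)) := by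
  rw [lintegral_exp_quadratic_eq_prod hA.isHermitian]
  simp_rw [lintegral_exp_neg_half_mul_sq (hA.eigenvalues_pos _)]
  rw [← ENNReal.ofReal_prod_of_nonneg fun i _ ↦ Real.sqrt_nonneg _,
    ← Real.sqrt_prod _ fun i _ ↦ by have := hA.eigenvalues_pos i; positivity]
  have hdet : ∏ i, hA.isHermitian.eigenvalues i = A.det := by
    simpa using hA.isHermitian.det_eq_prod_eigenvalues.symm
  rw [Finset.prod_div_distrib, hdet, Finset.prod_const, Finset.card_univ, Fintype.card_fin,
    Real.sqrt_eq_rpow, Real.div_rpow (by positivity) hA.det_pos.le, ← Real.rpow_natCast,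
    ← Real.rpow_mul (by positivity), neg_div, Real.rpow_neg hA.det_pos.le, div_eq_mul_inv]
  ring_nf

theorem lintegral_exp_quadratic_eq_top (hA : A.IsHermitian) (hA' : ¬ A.PosDef) :
    ∫⁻ y : Fin N → ℝ, ENNReal.ofReal (Real.exp (-(1 / 2) * (y ⬝ᵥ A *ᵥ y))) = ⊤ := by
  rw [hA.posDef_iff_eigenvalues_pos] at hA'
  push Not at hA'
  obtain ⟨i, hi⟩ := hA'
  rw [lintegral_exp_quadratic_eq_prod hA]
  refine WithTop.prod_eq_top (Finset.mem_univ i) (lintegral_exp_neg_half_mul_sq_eq_top hi)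
    fun j _ ↦ ?_
  rcases le_or_gt (hA.eigenvalues j) 0 with hj | hj
  · rw [lintegral_exp_neg_half_mul_sq_eq_top hj]
    exact ENNReal.top_ne_zero
  · rw [lintegral_exp_neg_half_mul_sq hj]
    exact (ENNReal.ofReal_pos.mpr (by positivity)).ne'

end Quadratic

section GaussDensity

variable {N : ℕ} {S0 S1 S2 : Matrix (Fin N) (Fin N) ℝ}

theorem gaussDensity_div_mul (h1 : S1.PosDef) (y : Fin N → ℝ) :
    gaussDensity S2 y / gaussDensity S1 y * gaussDensity S0 y =
      S2.det ^ (-(1 : ℝ) / 2) / S1.det ^ (-(1 : ℝ) / 2) *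
          ((2 * Real.pi) ^ (-(N : ℝ) / 2) * S0.det ^ (-(1 : ℝ) / 2)) *
        Real.exp (-(1 / 2) * (y ⬝ᵥ (S0⁻¹ + (S2⁻¹ - S1⁻¹)) *ᵥ y)) := by
  have hd : S1.det ^ (-(1 : ℝ) / 2) ≠ 0 := (Real.rpow_pos_of_pos h1.det_pos _).ne'
  have hexp : Real.exp (-(1 / 2) * (y ⬝ᵥ (S0⁻¹ + (S2⁻¹ - S1⁻¹)) *ᵥ y)) =
      Real.exp (-(1 / 2) * (y ⬝ᵥ S2⁻¹ *ᵥ y)) / Real.exp (-(1 / 2) * (y ⬝ᵥ S1⁻¹ *ᵥ y)) *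
        Real.exp (-(1 / 2) * (y ⬝ᵥ S0⁻¹ *ᵥ y)) := by
    rw [← Real.exp_sub, ← Real.exp_add, add_mulVec, sub_mulVec, dotProduct_add, dotProduct_sub]
    ring_nf
  rw [hexp]
  simp only [gaussDensity]
  field_simp

theorem lintegral_gaussDensity_div_mul_eq_mul (h0 : S0.PosDef) (h1 : S1.PosDef)
    (h2 : S2.PosDef) :
    ∫⁻ y : Fin N → ℝ,
        ENNReal.ofReal (gaussDensity S2 y / gaussDensity S1 y * gaussDensity S0 y) =
      ENNReal.ofReal (S2.det ^ (-(1 : ℝ) / 2) / S1.det ^ (-(1 : ℝ) / 2) *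
          ((2 * Real.pi) ^ (-(N : ℝ) / 2) * S0.det ^ (-(1 : ℝ) / 2))) *
        ∫⁻ y : Fin N → ℝ,
          ENNReal.ofReal (Real.exp (-(1 / 2) * (y ⬝ᵥ (S0⁻¹ + (S2⁻¹ - S1⁻¹)) *ᵥ y))) := by
  have := h0.det_pos
  have := h1.det_pos
  have := h2.det_pos
  simp_rw [gaussDensity_div_mul h1]
  rw [← lintegral_const_mul' _ _ ENNReal.ofReal_ne_top]
  exact lintegral_congr fun y ↦ ENNReal.ofReal_mul (by positivity)

theorem lintegral_gaussDensity_div_mul (h0 : S0.PosDef) (h1 : S1.PosDef) (h2 : S2.PosDef)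
    (hA : (S0⁻¹ + (S2⁻¹ - S1⁻¹)).PosDef) :
    ∫⁻ y : Fin N → ℝ,
        ENNReal.ofReal (gaussDensity S2 y / gaussDensity S1 y * gaussDensity S0 y) =
      ENNReal.ofReal √(S1.det / S2.det / (S0.det * (S0⁻¹ + (S2⁻¹ - S1⁻¹)).det)) := by
  have h0' := h0.det_pos
  have h1' := h1.det_pos
  have h2' := h2.det_pos
  have hA' := hA.det_pos
  rw [lintegral_gaussDensity_div_mul_eq_mul h0 h1 h2, lintegral_exp_quadratic hA,
    ← ENNReal.ofReal_mul (by positivity), Real.sqrt_div (by positivity),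
    Real.sqrt_div h1'.le, Real.sqrt_mul h0'.le]
  simp only [neg_div, Real.rpow_neg h0'.le, Real.rpow_neg h1'.le, Real.rpow_neg h2'.le,
    Real.rpow_neg hA'.le, Real.rpow_neg Real.two_pi_pos.le, ← Real.sqrt_eq_rpow]
  congr 1
  field_simp

theorem lintegral_gaussDensity_div_mul_eq_top (h0 : S0.PosDef) (h1 : S1.PosDef) (h2 : S2.PosDef)
    (hA : ¬ (S0⁻¹ + (S2⁻¹ - S1⁻¹)).PosDef) :
    ∫⁻ y : Fin N → ℝ,
        ENNReal.ofReal (gaussDensity S2 y / gaussDensity S1 y * gaussDensity S0 y) = ⊤ := by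
  have := h0.det_pos
  have := h1.det_pos
  have := h2.det_pos
  rw [lintegral_gaussDensity_div_mul_eq_mul h0 h1 h2, lintegral_exp_quadratic_eq_top
    (h0.isHermitian.inv.add (h2.isHermitian.inv.sub h1.isHermitian.inv)) hA]
  exact ENNReal.mul_top (ENNReal.ofReal_pos.mpr (by positivity)).ne'

end GaussDensity

/-- Characterization of dominance between Gaussian measures w.r.t. `N(0, σ²I)`:
`∫ (dP2/dP0)/(dP1/dP0) dP0 ≤ 1` iff `I + σ²(Σ2⁻¹ − Σ1⁻¹)` is positive definite and
`det(Σ2⁻¹Σ1) ≤ det(I + σ²(Σ2⁻¹ − Σ1⁻¹))`; moreover if `I + σ²(Σ2⁻¹ − Σ1⁻¹)` is not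
positive semidefinite then the integral diverges. -/
theorem stmt_4 {N : ℕ} (σ2 : ℝ) (hσ : 0 < σ2)
    (S1 S2 : Matrix (Fin N) (Fin N) ℝ) (h1 : S1.PosDef) (h2 : S2.PosDef) :
    ((∫⁻ y, ENNReal.ofReal
        (gaussDensity S2 y / gaussDensity S1 y * gaussDensity (σ2 • (1 : Matrix (Fin N) (Fin N) ℝ)) y)
        ∂(volume : Measure (Fin N → ℝ)) ≤ 1) ↔
      ((1 + σ2 • (S2⁻¹ - S1⁻¹)).PosDef ∧
        (S2⁻¹ * S1).det ≤ (1 + σ2 • (S2⁻¹ - S1⁻¹)).det)) ∧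
    (¬ (1 + σ2 • (S2⁻¹ - S1⁻¹)).PosSemidef →
      ∫⁻ y, ENNReal.ofReal
        (gaussDensity S2 y / gaussDensity S1 y * gaussDensity (σ2 • (1 : Matrix (Fin N) (Fin N) ℝ)) y)
        ∂(volume : Measure (Fin N → ℝ)) = ⊤) := by
  set S0 : Matrix (Fin N) (Fin N) ℝ := σ2 • 1 with hS0
  have h0 : S0.PosDef := PosDef.one.smul hσ
  have hmul : 1 + σ2 • (S2⁻¹ - S1⁻¹) = S0 * (S0⁻¹ + (S2⁻¹ - S1⁻¹)) := by
    rw [mul_add, mul_nonsing_inv _ h0.det_pos.ne'.isUnit, hS0, smul_mul_assoc, one_mul]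
  have hsmul : 1 + σ2 • (S2⁻¹ - S1⁻¹) = σ2 • (S0⁻¹ + (S2⁻¹ - S1⁻¹)) := by
    rw [hmul, hS0, smul_mul_assoc, one_mul]
  have hpos : (1 + σ2 • (S2⁻¹ - S1⁻¹)).PosDef ↔ (S0⁻¹ + (S2⁻¹ - S1⁻¹)).PosDef := by
    refine ⟨fun h ↦ ?_, fun h ↦ hsmul ▸ h.smul hσ⟩
    simpa [hsmul, smul_smul, hσ.ne'] using h.smul (inv_pos.mpr hσ)
  have hdet : (S2⁻¹ * S1).det = S1.det / S2.det := by
    rw [det_mul, det_nonsing_inv, Ring.inverse_eq_inv', inv_mul_eq_div]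
  refine ⟨?_, fun h ↦ lintegral_gaussDensity_div_mul_eq_top h0 h1 h2
    fun h' ↦ h (hpos.mpr h').posSemidef⟩
  rw [hpos]
  by_cases hA : (S0⁻¹ + (S2⁻¹ - S1⁻¹)).PosDef
  · rw [lintegral_gaussDensity_div_mul h0 h1 h2 hA, ENNReal.ofReal_le_one, Real.sqrt_le_one,
      div_le_one (mul_pos h0.det_pos hA.det_pos), hmul, hdet, det_mul]
    exact (and_iff_right hA).symm
  · simp [lintegral_gaussDensity_div_mul_eq_top h0 h1 h2 hA, hA]
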